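/- arXiv:math/0406314 — 3 statements merged into one kernel-verified Lean document; each statement's English description precedes it below -/
import Mathlib

section
/- Let R be a commutative ring and S a commutative R-algebra with a finite group G acting on S by R-algebra automorphisms, and assume the fixed subring S^G equals the image of R in S. Then the map Θ : S ⊗_R S → ∏_{γ∈G} S is surjective if and only if it is bijective; that is, S/R is a G-Galois extension if and only if Θ is an epimorphism. -/
open scoped TensorProduct

/-- The map `Θ : S ⊗[R] S → ∏_{γ ∈ G} S`, `Θ(u ⊗ v) = (u · (γ • v))_{γ ∈ G}`,
where `G` acts on `S` via a homomorphism `ρ : G →* (S ≃ₐ[R] S)`. -/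
noncomputable def thetaMap (R S G : Type) [CommRing R] [CommRing S] [Algebra R S]
    [Group G] (ρ : G →* (S ≃ₐ[R] S)) : S ⊗[R] S →ₗ[R] (G → S) :=
  TensorProduct.lift
    (LinearMap.mk₂ R (fun u v γ => u * ρ γ v)
      (fun u u' v => by funext γ; simp [add_mul])
      (fun c u v => by funext γ; simp [smul_mul_assoc])
      (fun u v v' => by funext γ; simp [mul_add])
      (fun c u v => by funext γ; simp [mul_smul_comm]))

/-- `S/R` is a `G`-Galois extension: the fixed subring `S^G` equals the image of `R`
and `Θ` is bijective. -/
def IsBNGaloisExtension (R S G : Type) [CommRing R] [CommRing S] [Algebra R S]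
    [Group G] (ρ : G →* (S ≃ₐ[R] S)) : Prop :=
  ({s : S | ∀ γ : G, ρ γ s = s} = Set.range (algebraMap R S)) ∧
  Function.Bijective (thetaMap R S G ρ)

@[simp]
theorem thetaMap_tmul (R S G : Type) [CommRing R] [CommRing S] [Algebra R S]
    [Group G] (ρ : G →* (S ≃ₐ[R] S)) (u v : S) (γ : G) :
    thetaMap R S G ρ (u ⊗ₜ[R] v) γ = u * ρ γ v := rfl

/-- If `∑ xᵢ ⊗ yᵢ` is sent by `Θ` to the indicator function of `1`, then every `v` expands as
`∑ tr(v xᵢ) yᵢ`. -/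
theorem sum_trace_mul_eq (R S G : Type) [CommRing R] [CommRing S] [Algebra R S]
    [Group G] [Fintype G] [DecidableEq G] (ρ : G →* (S ≃ₐ[R] S)) (s : Finset (S × S))
    (hs : ∀ γ : G, ∑ p ∈ s, p.1 * ρ γ p.2 = if γ = 1 then 1 else 0) (v : S) :
    ∑ p ∈ s, (∑ γ : G, ρ γ (v * p.1)) * p.2 = v := by
  have key (γ : G) : ∑ p ∈ s, ρ γ (v * p.1) * p.2 = if γ = 1 then v else 0 := by
    have h := congrArg (fun t => ρ γ (v * t)) (hs γ⁻¹)
    have hinv (a : S) : ρ γ (ρ γ⁻¹ a) = a := by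
      rw [← AlgEquiv.mul_apply, ← map_mul, mul_inv_cancel, map_one, AlgEquiv.one_apply]
    simp only [Finset.mul_sum, map_sum, map_mul, hinv, inv_eq_one] at h
    simp only [map_mul, mul_assoc]
    rw [h]
    split_ifs with hγ <;> simp [hγ]
  simp_rw [Finset.sum_mul]
  rw [Finset.sum_comm]
  simp only [key, Finset.sum_ite_eq', Finset.mem_univ, if_true]

/-- Under the same hypothesis, and if `S^G` is the image of `R`, an element of `S ⊗[R] S` can be
recovered from its image under `Θ`. -/
theorem sum_thetaMap_tmul_eq (R S G : Type) [CommRing R] [CommRing S] [Algebra R S]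
    [Group G] [Fintype G] [DecidableEq G] (ρ : G →* (S ≃ₐ[R] S))
    (hfix : {s : S | ∀ γ : G, ρ γ s = s} = Set.range (algebraMap R S)) (s : Finset (S × S))
    (hs : ∀ γ : G, ∑ p ∈ s, p.1 * ρ γ p.2 = if γ = 1 then 1 else 0) (z : S ⊗[R] S) :
    ∑ p ∈ s, (∑ γ : G, thetaMap R S G ρ z γ * ρ γ p.1) ⊗ₜ[R] p.2 = z := by
  induction z with
  | zero => simp
  | add a b ha hb =>
    simp only [map_add, Pi.add_apply, add_mul, Finset.sum_add_distrib, TensorProduct.add_tmul,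
      ha, hb]
  | tmul u v =>
    have htr (a : S) : ∃ r : R, algebraMap R S r = ∑ γ : G, ρ γ a := by
      have h : ∑ γ : G, ρ γ a ∈ {s : S | ∀ γ : G, ρ γ s = s} := by
        intro τ
        simp_rw [map_sum, ← AlgEquiv.mul_apply, ← map_mul]
        exact Equiv.sum_comp (Equiv.mulLeft τ) fun γ => ρ γ a
      rwa [hfix] at h
    choose r hr using htr
    calc ∑ p ∈ s, (∑ γ : G, thetaMap R S G ρ (u ⊗ₜ[R] v) γ * ρ γ p.1) ⊗ₜ[R] p.2
        = ∑ p ∈ s, u ⊗ₜ[R] ((∑ γ : G, ρ γ (v * p.1)) * p.2) := by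
          refine Finset.sum_congr rfl fun p _ => ?_
          simp only [thetaMap_tmul, mul_assoc, ← map_mul]
          rw [← Finset.mul_sum, ← hr, ← Algebra.smul_def, mul_comm, ← Algebra.smul_def,
            TensorProduct.smul_tmul]
      _ = u ⊗ₜ[R] v := by
          rw [← TensorProduct.tmul_sum, sum_trace_mul_eq R S G ρ s hs v]

/-- If the fixed subring equals the image of `R`, then `Θ` is surjective iff it is
bijective; that is, `S/R` is `G`-Galois iff `Θ` is an epimorphism. -/
theorem stmt0 (R S G : Type) [CommRing R] [CommRing S] [Algebra R S]
    [Group G] [Fintype G] (ρ : G →* (S ≃ₐ[R] S))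
    (hfix : {s : S | ∀ γ : G, ρ γ s = s} = Set.range (algebraMap R S)) :
    Function.Surjective (thetaMap R S G ρ) ↔ Function.Bijective (thetaMap R S G ρ) := by
  classical
  refine ⟨fun hsurj => ⟨?_, hsurj⟩, fun h => h.surjective⟩
  obtain ⟨w, hw⟩ := hsurj (Pi.single 1 1)
  obtain ⟨s, rfl⟩ := TensorProduct.exists_finset w
  have hs (γ : G) : ∑ p ∈ s, p.1 * ρ γ p.2 = if γ = 1 then 1 else 0 := by
    simpa [Pi.single_apply] using congrFun hw γ
  intro a b hab
  rw [← sum_thetaMap_tmul_eq R S G ρ hfix s hs a, hab, sum_thetaMap_tmul_eq R S G ρ hfix s hs b]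
end

section
/- If S/R is a G-Galois extension of commutative rings, then for every s ∈ S the trace tr(s) = ∑_{γ∈G} γ•s lies in the image of R in S, and the trace is surjective onto R: there exists an element s ∈ S with ∑_{γ∈G} γ•s = 1. -/
open scoped TensorProduct

/-- The trace `s ↦ ∑_{γ∈G} γ•s` as an `R`-linear endomorphism of `S`. -/
def groupTrace {R S G : Type} [CommRing R] [CommRing S] [Algebra R S]
    [Group G] [Fintype G] (ρ : G →* (S ≃ₐ[R] S)) : S →ₗ[R] S :=
  ∑ γ : G, (ρ γ).toLinearMap

section

variable {R S G : Type} [CommRing R] [CommRing S] [Algebra R S]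
  [Group G] (ρ : G →* (S ≃ₐ[R] S))

theorem groupTrace_apply [Fintype G] (s : S) : groupTrace ρ s = ∑ γ : G, ρ γ s := by
  simp [groupTrace]

theorem map_groupTrace [Fintype G] (γ : G) (s : S) :
    ρ γ (groupTrace ρ s) = groupTrace ρ s := by
  simp only [groupTrace_apply, map_sum]
  exact Fintype.sum_equiv (Equiv.mulLeft γ) _ _ fun δ => by simp

theorem groupTrace_mem_range_algebraMap [Fintype G]
    (hgal : IsBNGaloisExtension R S G ρ) (s : S) :
    groupTrace ρ s ∈ Set.range (algebraMap R S) := by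
  rw [← hgal.1]
  exact fun γ => map_groupTrace ρ γ s

theorem exists_sum_mul_apply_eq_of_surjective_thetaMap
    (h : Function.Surjective (thetaMap R S G ρ)) (f : G → S) :
    ∃ t : Finset (S × S), ∀ γ : G, ∑ p ∈ t, p.1 * ρ γ p.2 = f γ := by
  obtain ⟨z, hz⟩ := h f
  obtain ⟨t, rfl⟩ := TensorProduct.exists_finset z
  refine ⟨t, fun γ => ?_⟩
  simpa [thetaMap] using congrFun hz γ

/-- A dual basis `(xᵢ, yᵢ)` with `∑ xᵢ · γ(yᵢ) = δ_{γ,1}` expands every `s` as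
`∑ xᵢ · tr(yᵢ s)`. -/
theorem sum_mul_groupTrace_mul [Fintype G] [DecidableEq G] {t : Finset (S × S)}
    (ht : ∀ γ : G, ∑ p ∈ t, p.1 * ρ γ p.2 = (Pi.single 1 1 : G → S) γ) (s : S) :
    ∑ p ∈ t, p.1 * groupTrace ρ (p.2 * s) = s := by
  simp only [groupTrace_apply, Finset.mul_sum, map_mul, ← mul_assoc]
  rw [Finset.sum_comm]
  simp [← Finset.sum_mul, ht, Pi.single_apply]

theorem exists_groupTrace_eq_one [Fintype G] (hgal : IsBNGaloisExtension R S G ρ) :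
    ∃ s : S, groupTrace ρ s = 1 := by
  classical
  obtain ⟨t, ht⟩ := exists_sum_mul_apply_eq_of_surjective_thetaMap ρ hgal.2.2 (Pi.single 1 1)
  have expand := sum_mul_groupTrace_mul ρ ht
  let I : Ideal R := (LinearMap.range (groupTrace ρ)).comap (Algebra.linearMap R S)
  have expand_smul (s : S) : ∃ c : S × S → R, (∀ p, c p ∈ I) ∧ ∑ p ∈ t, c p • p.1 = s := by
    choose c hc using fun p : S × S => groupTrace_mem_range_algebraMap ρ hgal (p.2 * s)
    refine ⟨c, fun p => ⟨p.2 * s, (hc p).symm⟩, ?_⟩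
    simpa only [Algebra.smul_def, hc, mul_comm] using expand s
  have hfg : (⊤ : Submodule R S).FG := by
    refine ⟨t.image Prod.fst, top_le_iff.mp fun s _ => ?_⟩
    obtain ⟨c, -, rfl⟩ := expand_smul s
    exact Submodule.sum_mem _ fun p hp =>
      Submodule.smul_mem _ _ (Submodule.subset_span (Finset.mem_image_of_mem _ hp))
  have hle : (⊤ : Submodule R S) ≤ I • ⊤ := fun s _ => by
    obtain ⟨c, hc, rfl⟩ := expand_smul s
    exact Submodule.sum_mem _ fun p _ => Submodule.smul_mem_smul (hc p) trivial
  obtain ⟨r, ⟨s, hs⟩, hr⟩ :=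
    Submodule.exists_sub_one_mem_and_smul_eq_zero_of_fg_of_le_smul I ⊤ hfg hle
  have hr1 : algebraMap R S r = 0 := by
    simpa [Algebra.smul_def] using hr 1 trivial
  exact ⟨-s, by simp [hs, hr1]⟩

end

/-- If `S/R` is `G`-Galois, then every trace `tr(s) = ∑_{γ∈G} γ•s` lies in the image
of `R`, and the trace is surjective onto `R`: some `s ∈ S` has `∑_{γ∈G} γ•s = 1`. -/
theorem stmt4 (R S G : Type) [CommRing R] [CommRing S] [Algebra R S]
    [Group G] [Fintype G] (ρ : G →* (S ≃ₐ[R] S))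
    (hgal : IsBNGaloisExtension R S G ρ) :
    (∀ s : S, (∑ γ : G, ρ γ s) ∈ Set.range (algebraMap R S)) ∧
    (∃ s : S, (∑ γ : G, ρ γ s) = 1) := by
  simp only [← groupTrace_apply]
  exact ⟨groupTrace_mem_range_algebraMap ρ hgal, exists_groupTrace_eq_one ρ hgal⟩
end

section
/- Let S/R be a G-Galois extension of commutative rings such that the action of G on S is faithful. If both R and S are connected (their only idempotents are 0 and 1), then every R-algebra automorphism of S is given by the action of a unique element of G; that is, the group homomorphism G → Aut_{R-alg}(S) induced by the action is bijective. -/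
open scoped TensorProduct

/-- `thetaMap` as an algebra homomorphism. -/
noncomputable def thetaAlgHom (R S G : Type) [CommRing R] [CommRing S] [Algebra R S]
    [Group G] (ρ : G →* (S ≃ₐ[R] S)) : S ⊗[R] S →ₐ[R] (G → S) :=
  AlgHom.pi fun γ =>
    Algebra.TensorProduct.productMap (AlgHom.id R S) (ρ γ : S →ₐ[R] S)

theorem coe_thetaAlgHom (R S G : Type) [CommRing R] [CommRing S] [Algebra R S]
    [Group G] (ρ : G →* (S ≃ₐ[R] S)) :
    ⇑(thetaAlgHom R S G ρ) = thetaMap R S G ρ := by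
  have h : (thetaAlgHom R S G ρ).toLinearMap = thetaMap R S G ρ := by
    ext u v γ
    simp [thetaAlgHom, thetaMap]
  exact congrArg DFunLike.coe h

theorem thetaAlgHom_tmul (R S G : Type) [CommRing R] [CommRing S] [Algebra R S]
    [Group G] (ρ : G →* (S ≃ₐ[R] S)) (u v : S) (γ : G) :
    thetaAlgHom R S G ρ (u ⊗ₜ v) γ = u * ρ γ v := by
  simp [thetaAlgHom]

/-- If `Θ` is bijective and `S` is connected, every `R`-algebra endomorphism of `S` is given by
the action of some element of `G`. -/
theorem exists_eq_of_thetaMap_bijective (R S G : Type) [CommRing R] [CommRing S] [Algebra R S]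
    [Group G] [Finite G] (ρ : G →* (S ≃ₐ[R] S))
    (hΘ : Function.Bijective (thetaMap R S G ρ))
    (hconn : ∀ e : S, IsIdempotentElem e → e = 0 ∨ e = 1) (σ : S →ₐ[R] S) :
    ∃ γ, ∀ v, ρ γ v = σ v := by
  classical
  have := Fintype.ofFinite G
  rw [← coe_thetaAlgHom] at hΘ
  let ψ : S ⊗[R] S →ₐ[R] S := Algebra.TensorProduct.productMap (AlgHom.id R S) σ
  choose x hx using fun γ : G => hΘ.surjective (Pi.single γ 1)
  have hidem (γ : G) : IsIdempotentElem (x γ) := by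
    apply hΘ.injective
    rw [map_mul, hx, ← Pi.single_mul, one_mul]
  have hsum : ∑ γ, x γ = 1 := by
    apply hΘ.injective
    simp only [map_sum, hx, map_one]
    exact Finset.univ_sum_single (1 : G → S)
  have hmul (γ : G) (v : S) : x γ * (1 ⊗ₜ v) = x γ * (ρ γ v ⊗ₜ 1) := by
    apply hΘ.injective
    rw [map_mul, map_mul, hx]
    funext δ
    obtain rfl | hδ := eq_or_ne δ γ
    · simp [thetaAlgHom_tmul]
    · simp [Pi.single_eq_of_ne hδ]
  have hψ (γ : G) : ψ (x γ) = 0 ∨ ψ (x γ) = 1 := hconn _ ((hidem γ).map ψ)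
  obtain ⟨γ, hγ⟩ : ∃ γ, ψ (x γ) = 1 := by
    by_contra! h
    have h0 (γ : G) : ψ (x γ) = 0 := (hψ γ).resolve_right (h γ)
    refine h 1 ?_
    rw [h0, ← map_one ψ, ← hsum, map_sum, Finset.sum_eq_zero fun γ _ => h0 γ]
  refine ⟨γ, fun v => ?_⟩
  have h := congrArg ψ (hmul γ v)
  rw [map_mul, map_mul, hγ, one_mul, one_mul] at h
  simpa [ψ] using h.symm

/-- If `S/R` is `G`-Galois with faithful `G`-action and both `R` and `S` are
connected (their only idempotents are `0` and `1`), then the induced map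
`G → Aut_{R-alg}(S)` is bijective. -/
theorem stmt6 (R S G : Type) [CommRing R] [CommRing S] [Algebra R S]
    [Group G] [Fintype G] (ρ : G →* (S ≃ₐ[R] S))
    (hgal : IsBNGaloisExtension R S G ρ)
    (hfaithful : Function.Injective ρ)
    (hconnR : ∀ e : R, IsIdempotentElem e → e = 0 ∨ e = 1)
    (hconnS : ∀ e : S, IsIdempotentElem e → e = 0 ∨ e = 1) :
    Function.Bijective (ρ : G → (S ≃ₐ[R] S)) := by
  refine ⟨hfaithful, fun σ => ?_⟩
  obtain ⟨γ, hγ⟩ := exists_eq_of_thetaMap_bijective R S G ρ hgal.2 hconnS (σ : S →ₐ[R] S)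
  exact ⟨γ, AlgEquiv.ext hγ⟩
end
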